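/- arXiv:2309.06427 — 6 statements merged into one kernel-verified Lean document; each statement's English description precedes it below -/
import Mathlib

section
/- Let S be a symmetric block tridiagonal matrix (n×n blocks of size m×m) all of whose diagonal blocks are invertible, with left/right stair splittings S = Ψl − Pl = Ψr − Pr. Then the matrices Ψl⁻¹ * Pl and Ψr⁻¹ * Pr have the same characteristic polynomial; in particular they have the same spectrum. -/
open Matrix

namespace StairPrecond

/-- Real matrices indexed as n×n arrays of m×m blocks. -/
abbrev Mat (n m : ℕ) := Matrix (Fin n × Fin m) (Fin n × Fin m) ℝ

/-- Vectors compatible with `Mat n m`. -/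
abbrev Vec (n m : ℕ) := Fin n × Fin m → ℝ

/-- The (i,j)-block of a block matrix. -/
def blockOf {n m : ℕ} (M : Mat n m) (i j : Fin n) : Matrix (Fin m) (Fin m) ℝ :=
  fun a b => M (i, a) (j, b)

/-- A matrix is block tridiagonal if its (i,j)-block vanishes whenever |i - j| > 1. -/
def IsBlockTridiag {n m : ℕ} (M : Mat n m) : Prop :=
  ∀ i j : Fin n, (i.val + 1 < j.val ∨ j.val + 1 < i.val) → blockOf M i j = 0

/-- The block-diagonal part `D` of a matrix: keep only the diagonal blocks. -/
def blockDiagPart {n m : ℕ} (M : Mat n m) : Mat n m :=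
  fun p q => if p.1 = q.1 then M p q else 0

/-- The left stair Ψl: diagonal blocks everywhere, off-diagonal blocks only in
block rows of odd index (0-indexed). -/
def stairL {n m : ℕ} (M : Mat n m) : Mat n m :=
  fun p q =>
    if p.1 = q.1 ∨ (Odd p.1.val ∧ (p.1.val = q.1.val + 1 ∨ q.1.val = p.1.val + 1)) then M p q
    else 0

/-- The right stair Ψr: diagonal blocks everywhere, off-diagonal blocks only in
block rows of even index (0-indexed). -/
def stairR {n m : ℕ} (M : Mat n m) : Mat n m :=
  fun p q =>
    if p.1 = q.1 ∨ (Even p.1.val ∧ (p.1.val = q.1.val + 1 ∨ q.1.val = p.1.val + 1)) then M p q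
    else 0

/-- Pl = Ψl − S. -/
def Pl {n m : ℕ} (S : Mat n m) : Mat n m := stairL S - S

/-- Pr = Ψr − S. -/
def Pr {n m : ℕ} (S : Mat n m) : Mat n m := stairR S - S

/-- The additive stair preconditioner Φadd⁻¹ = (1/2) • (Ψl⁻¹ + Ψr⁻¹). -/
noncomputable def Phiadd {n m : ℕ} (S : Mat n m) : Mat n m :=
  (1 / 2 : ℝ) • ((stairL S)⁻¹ + (stairR S)⁻¹)

/-- The symmetric stair preconditioner Φsym⁻¹ = Ψl⁻¹ + Ψr⁻¹ − D⁻¹. -/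
noncomputable def Phisym {n m : ℕ} (S : Mat n m) : Mat n m :=
  (stairL S)⁻¹ + (stairR S)⁻¹ - (blockDiagPart S)⁻¹

/-- All diagonal blocks are invertible m×m matrices. -/
def DiagBlocksInvertible {n m : ℕ} (M : Mat n m) : Prop :=
  ∀ i : Fin n, IsUnit (blockOf M i i)

/-- v_e : the part of v supported on blocks of odd index (0-indexed). -/
def vE {n m : ℕ} (v : Vec n m) : Vec n m := fun p => if Odd p.1.val then v p else 0

/-- v_o : the part of v supported on blocks of even index (0-indexed). -/
def vO {n m : ℕ} (v : Vec n m) : Vec n m := fun p => if Even p.1.val then v p else 0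

/-- A stair matrix: block tridiagonal, with off-diagonal blocks nonzero only in
block rows of a fixed parity (a left stair has them only in odd-indexed rows,
a right stair only in even-indexed rows, 0-indexed). -/
def IsStairMatrix {n m : ℕ} (Ψ : Mat n m) : Prop :=
  IsBlockTridiag Ψ ∧
    ((∀ i j : Fin n, i ≠ j → Even i.val → blockOf Ψ i j = 0) ∨
     (∀ i j : Fin n, i ≠ j → Odd i.val → blockOf Ψ i j = 0))

/-- If `D` is invertible and commutes (through its inverse) with `E`, while `F` and `G` are
respectively of the forms `(1 - E) F E` and `E G (1 - E)`, then the splittings of `D + F + G` with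
left factors `D + F` and `D + G` have iteration matrices with the same characteristic polynomial. -/
lemma charpoly_inv_mul_neg_eq_of_projection {ι R : Type*} [Fintype ι] [DecidableEq ι] [CommRing R]
    {D D' E F G : Matrix ι ι R} (hD : D' * D = 1) (hE : E * D' = D' * E)
    (hEF : E * F = 0) (hFE : F * E = F) (hEG : E * G = G) (hGE : G * E = 0) :
    ((D + F)⁻¹ * -G).charpoly = ((D + G)⁻¹ * -F).charpoly := by
  obtain ⟨A, hA⟩ : ∃ A, A = D' * F := ⟨_, rfl⟩
  obtain ⟨B, hB⟩ : ∃ B, B = D' * G := ⟨_, rfl⟩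
  have hEA : E * A = 0 := by rw [hA, ← mul_assoc, hE, mul_assoc, hEF, mul_zero]
  have hAE : A * E = A := by rw [hA, mul_assoc, hFE]
  have hEB : E * B = B := by rw [hB, ← mul_assoc, hE, mul_assoc, hEG]
  have hBE : B * E = 0 := by rw [hB, mul_assoc, hGE, mul_zero]
  have hAA : A * A = 0 := by
    calc A * A = A * E * A := by rw [hAE]
      _ = 0 := by rw [mul_assoc, hEA, mul_zero]
  have hBB : B * B = 0 := by
    calc B * B = B * (E * B) := by rw [hEB]
      _ = 0 := by rw [← mul_assoc, hBE, zero_mul]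
  have hF : (D + F)⁻¹ = (1 - A) * D' := by
    refine Matrix.inv_eq_left_inv ?_
    rw [mul_assoc, mul_add, hD, ← hA]
    linear_combination (norm := noncomm_ring) -hAA
  have hG : (D + G)⁻¹ = (1 - B) * D' := by
    refine Matrix.inv_eq_left_inv ?_
    rw [mul_assoc, mul_add, hD, ← hB]
    linear_combination (norm := noncomm_ring) -hBB
  rw [hF, hG, mul_assoc, mul_assoc, mul_neg D', mul_neg D', ← hA, ← hB]
  calc ((1 - A) * -B).charpoly = (-B * (1 - A)).charpoly := Matrix.charpoly_mul_comm _ _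
    _ = (E * (-B * (1 - A))).charpoly := by rw [← mul_assoc, mul_neg, hEB]
    _ = (-B * (1 - A) * E).charpoly := Matrix.charpoly_mul_comm _ _
    _ = (B * A).charpoly := by
      rw [mul_assoc, sub_mul, one_mul, hAE, neg_mul, mul_sub, hBE, zero_sub, neg_neg]
    _ = (E * ((1 - B) * -A)).charpoly := by
      rw [sub_mul, one_mul, mul_sub, mul_neg, hEA, ← mul_assoc, hEB, mul_neg, neg_zero, zero_sub,
        neg_neg]
    _ = ((1 - B) * -A * E).charpoly := Matrix.charpoly_mul_comm _ _
    _ = ((1 - B) * -A).charpoly := by rw [mul_assoc, neg_mul, hAE]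

/-- The block-diagonal matrix of the inverses of the diagonal blocks. -/
noncomputable def blockDiagInv {n m : ℕ} (M : Mat n m) : Mat n m :=
  fun p q => if p.1 = q.1 then (blockOf M p.1 p.1)⁻¹ p.2 q.2 else 0

lemma blockDiagInv_mul_blockDiagPart {n m : ℕ} {M : Mat n m} (h : DiagBlocksInvertible M) :
    blockDiagInv M * blockDiagPart M = 1 := by
  ext ⟨i, a⟩ ⟨j, b⟩
  have hi : (blockOf M i i)⁻¹ * blockOf M i i = 1 :=
    Matrix.nonsing_inv_mul _ ((Matrix.isUnit_iff_isUnit_det _).1 (h i))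
  have hab := congrFun (congrFun hi a) b
  rw [Matrix.mul_apply] at hab
  rw [Matrix.mul_apply, Fintype.sum_prod_type, Finset.sum_eq_single i]
  · by_cases hij : i = j
    · subst hij
      simpa [blockDiagInv, blockDiagPart, blockOf, Matrix.one_apply] using hab
    · simp [blockDiagPart, hij]
  · intro k _ hk
    simp [blockDiagInv, hk.symm]
  · simp

/-- The coordinate projection onto the blocks of even index. -/
def evenProj (n m : ℕ) : Mat n m :=
  Matrix.diagonal fun p => if Even p.1.val then 1 else 0

lemma evenProj_mul_blockDiagInv {n m : ℕ} (M : Mat n m) :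
    evenProj n m * blockDiagInv M = blockDiagInv M * evenProj n m := by
  ext p q
  by_cases hpq : p.1 = q.1 <;> simp [evenProj, blockDiagInv, hpq]

lemma stairL_add_stairR {n m : ℕ} {M : Mat n m} (h : IsBlockTridiag M) :
    stairL M + stairR M = M + blockDiagPart M := by
  ext p q
  have h0 : p.1.val + 1 < q.1.val ∨ q.1.val + 1 < p.1.val → M p q = 0 := fun hpq =>
    congrFun (congrFun (h p.1 q.1 hpq) p.2) q.2
  simp only [stairL, stairR, blockDiagPart, Matrix.add_apply, Fin.ext_iff]
  grind

lemma evenProj_mul_stairL_sub {n m : ℕ} (M : Mat n m) :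
    evenProj n m * (stairL M - blockDiagPart M) = 0 := by
  ext p q
  simp only [evenProj, stairL, blockDiagPart, Matrix.diagonal_mul, Matrix.sub_apply, Fin.ext_iff,
    Matrix.zero_apply]
  grind

lemma stairL_sub_mul_evenProj {n m : ℕ} (M : Mat n m) :
    (stairL M - blockDiagPart M) * evenProj n m = stairL M - blockDiagPart M := by
  ext p q
  simp only [evenProj, stairL, blockDiagPart, Matrix.mul_diagonal, Matrix.sub_apply, Fin.ext_iff]
  grind

lemma evenProj_mul_stairR_sub {n m : ℕ} (M : Mat n m) :
    evenProj n m * (stairR M - blockDiagPart M) = stairR M - blockDiagPart M := by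
  ext p q
  simp only [evenProj, stairR, blockDiagPart, Matrix.diagonal_mul, Matrix.sub_apply, Fin.ext_iff]
  grind

lemma stairR_sub_mul_evenProj {n m : ℕ} (M : Mat n m) :
    (stairR M - blockDiagPart M) * evenProj n m = 0 := by
  ext p q
  simp only [evenProj, stairR, blockDiagPart, Matrix.mul_diagonal, Matrix.sub_apply, Fin.ext_iff,
    Matrix.zero_apply]
  grind

/-- The matrices Ψl⁻¹ * Pl and Ψr⁻¹ * Pr have the same characteristic polynomial,
and in particular the same spectrum. -/
theorem stair_splittings_same_charpoly {n m : ℕ} (hn : 0 < n) (hm : 0 < m)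
    (S : Mat n m) (hsymm : S.IsSymm) (htri : IsBlockTridiag S)
    (hdiag : DiagBlocksInvertible S) :
    ((stairL S)⁻¹ * Pl S).charpoly = ((stairR S)⁻¹ * Pr S).charpoly ∧
      spectrum ℝ ((stairL S)⁻¹ * Pl S) = spectrum ℝ ((stairR S)⁻¹ * Pr S) := by
  have hchar : ((stairL S)⁻¹ * Pl S).charpoly = ((stairR S)⁻¹ * Pr S).charpoly := by
    have hadd := stairL_add_stairR htri
    have hPl : Pl S = -(stairR S - blockDiagPart S) := by
      rw [Pl]
      linear_combination (norm := abel) hadd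
    have hPr : Pr S = -(stairL S - blockDiagPart S) := by
      rw [Pr]
      linear_combination (norm := abel) hadd
    have key := charpoly_inv_mul_neg_eq_of_projection (blockDiagInv_mul_blockDiagPart hdiag)
      (evenProj_mul_blockDiagInv S) (evenProj_mul_stairL_sub S) (stairL_sub_mul_evenProj S)
      (evenProj_mul_stairR_sub S) (stairR_sub_mul_evenProj S)
    rwa [add_sub_cancel, add_sub_cancel, ← hPl, ← hPr] at key
  refine ⟨hchar, ?_⟩
  ext μ
  rw [Matrix.mem_spectrum_iff_isRoot_charpoly, Matrix.mem_spectrum_iff_isRoot_charpoly, hchar]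

end StairPrecond
end

section
/- Let S be a symmetric block tridiagonal matrix all of whose diagonal blocks are invertible, with stair splittings S = Ψl − Pl = Ψr − Pr. If (λ, v) is an eigenpair of Ψl⁻¹ * Pl with λ ≠ 0, then v_e + λ • v_o ≠ 0 and (λ, v_e + λ • v_o) is an eigenpair of Ψr⁻¹ * Pr. -/
open Matrix

namespace StairPrecond

lemma IsBlockTridiag.apply_eq_zero {n m : ℕ} {S : Mat n m} (htri : IsBlockTridiag S)
    {p q : Fin n × Fin m} (h : p.1.val + 1 < q.1.val ∨ q.1.val + 1 < p.1.val) : S p q = 0 :=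
  congrFun (congrFun (htri p.1 q.1 h) p.2) q.2

lemma blockDiagPart_mulVec_apply {n m : ℕ} (S : Mat n m) (x : Vec n m) (i : Fin n) (a : Fin m) :
    (blockDiagPart S *ᵥ x) (i, a) = (blockOf S i i *ᵥ fun b => x (i, b)) a := by
  simp only [Matrix.mulVec, dotProduct, blockDiagPart, blockOf, Fintype.sum_prod_type, ite_mul,
    zero_mul]
  rw [Finset.sum_comm]
  simp

/-- If block row `i` of `D *ᵥ x` vanishes, then so does block `i` of `x`. -/
lemma DiagBlocksInvertible.eq_zero_of_mulVec {n m : ℕ} {S : Mat n m}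
    (hdiag : DiagBlocksInvertible S) {x : Vec n m} {i : Fin n}
    (h : ∀ a, (blockDiagPart S *ᵥ x) (i, a) = 0) (a : Fin m) : x (i, a) = 0 := by
  have hz : blockOf S i i *ᵥ (fun b => x (i, b)) = blockOf S i i *ᵥ 0 := by
    ext b
    rw [← blockDiagPart_mulVec_apply, h, Matrix.mulVec_zero, Pi.zero_apply]
  exact congrFun (Matrix.mulVec_injective_iff_isUnit.mpr (hdiag i) hz) a

/-- A matrix that is block triangular, with diagonal part that of `S`, for the splitting of the
block indices according to a predicate `c`, is invertible. -/
lemma DiagBlocksInvertible.isUnit_of_splitting {n m : ℕ} {S : Mat n m}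
    (hdiag : DiagBlocksInvertible S) (M : Mat n m) (c : Fin n → Prop)
    (h₁ : ∀ x p, ¬ c p.1 → (M *ᵥ x) p = (blockDiagPart S *ᵥ x) p)
    (h₂ : ∀ x : Vec n m, (∀ q, ¬ c q.1 → x q = 0) → M *ᵥ x = blockDiagPart S *ᵥ x) :
    IsUnit M := by
  rw [← Matrix.mulVec_injective_iff_isUnit]
  refine (injective_iff_map_eq_zero M.mulVecLin).mpr fun x hx => ?_
  rw [Matrix.mulVecLin_apply] at hx
  have hc : ∀ q, ¬ c q.1 → x q = 0 := fun q hq =>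
    hdiag.eq_zero_of_mulVec (fun a => by rw [← h₁ x (q.1, a) hq, hx, Pi.zero_apply]) q.2
  have hD := h₂ x hc
  ext q
  exact hdiag.eq_zero_of_mulVec (fun a => by rw [← hD, hx, Pi.zero_apply]) q.2

lemma stairL_mulVec_of_even {n m : ℕ} (S : Mat n m) (x : Vec n m) {p : Fin n × Fin m}
    (hp : Even p.1.val) : (stairL S *ᵥ x) p = (blockDiagPart S *ᵥ x) p := by
  simp [Matrix.mulVec, dotProduct, stairL, blockDiagPart, Nat.not_odd_iff_even.mpr hp]

lemma stairR_mulVec_of_odd {n m : ℕ} (S : Mat n m) (x : Vec n m) {p : Fin n × Fin m}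
    (hp : Odd p.1.val) : (stairR S *ᵥ x) p = (blockDiagPart S *ᵥ x) p := by
  simp [Matrix.mulVec, dotProduct, stairR, blockDiagPart, Nat.not_even_iff_odd.mpr hp]

lemma IsBlockTridiag.stairL_mulVec_of_odd {n m : ℕ} {S : Mat n m} (htri : IsBlockTridiag S)
    (x : Vec n m) {p : Fin n × Fin m} (hp : Odd p.1.val) : (stairL S *ᵥ x) p = (S *ᵥ x) p := by
  refine Finset.sum_congr rfl fun q _ => ?_
  congr 1
  simp only [stairL]
  split_ifs with h
  · rfl
  · refine (htri.apply_eq_zero ?_).symm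
    simp only [hp, true_and, Fin.ext_iff] at h
    omega

lemma IsBlockTridiag.stairR_mulVec_of_even {n m : ℕ} {S : Mat n m} (htri : IsBlockTridiag S)
    (x : Vec n m) {p : Fin n × Fin m} (hp : Even p.1.val) : (stairR S *ᵥ x) p = (S *ᵥ x) p := by
  refine Finset.sum_congr rfl fun q _ => ?_
  congr 1
  simp only [stairR]
  split_ifs with h
  · rfl
  · refine (htri.apply_eq_zero ?_).symm
    simp only [hp, true_and, Fin.ext_iff] at h
    omega

lemma IsBlockTridiag.mulVec_of_odd {n m : ℕ} {S : Mat n m} (htri : IsBlockTridiag S)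
    (x : Vec n m) {p : Fin n × Fin m} (hp : Odd p.1.val) :
    (S *ᵥ x) p = (blockDiagPart S *ᵥ vE x) p + (S *ᵥ vO x) p := by
  simp only [Matrix.mulVec, dotProduct, ← Finset.sum_add_distrib]
  refine Finset.sum_congr rfl fun q _ => ?_
  rcases Nat.even_or_odd q.1.val with hq | hq
  · simp [vE, vO, hq, Nat.not_odd_iff_even.mpr hq]
  · have hq' := Nat.not_even_iff_odd.mpr hq
    by_cases h : p.1 = q.1
    · simp [vE, vO, hq, hq', blockDiagPart, h]
    · have hS : S p q = 0 := htri.apply_eq_zero (by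
        rw [Fin.ext_iff] at h
        rw [Nat.odd_iff] at hp hq
        omega)
      simp [blockDiagPart, hS]

lemma IsBlockTridiag.mulVec_of_even {n m : ℕ} {S : Mat n m} (htri : IsBlockTridiag S)
    (x : Vec n m) {p : Fin n × Fin m} (hp : Even p.1.val) :
    (S *ᵥ x) p = (blockDiagPart S *ᵥ vO x) p + (S *ᵥ vE x) p := by
  simp only [Matrix.mulVec, dotProduct, ← Finset.sum_add_distrib]
  refine Finset.sum_congr rfl fun q _ => ?_
  rcases Nat.even_or_odd q.1.val with hq | hq
  · have hq' := Nat.not_odd_iff_even.mpr hq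
    by_cases h : p.1 = q.1
    · simp [vE, vO, hq, hq', blockDiagPart, h]
    · have hS : S p q = 0 := htri.apply_eq_zero (by
        rw [Fin.ext_iff] at h
        rw [Nat.even_iff] at hp hq
        omega)
      simp [blockDiagPart, hS]
  · simp [vE, vO, hq, Nat.not_even_iff_odd.mpr hq]

lemma blockDiagPart_mulVec_congr {n m : ℕ} (S : Mat n m) {x y : Vec n m} {p : Fin n × Fin m}
    (h : ∀ a, x (p.1, a) = y (p.1, a)) :
    (blockDiagPart S *ᵥ x) p = (blockDiagPart S *ᵥ y) p := by
  obtain ⟨i, a⟩ := p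
  rw [blockDiagPart_mulVec_apply, blockDiagPart_mulVec_apply, funext h]

lemma isUnit_stairL {n m : ℕ} {S : Mat n m} (htri : IsBlockTridiag S)
    (hdiag : DiagBlocksInvertible S) : IsUnit (stairL S) := by
  refine hdiag.isUnit_of_splitting _ (fun i => Odd i.val)
    (fun x p hp => stairL_mulVec_of_even S x (Nat.not_odd_iff_even.mp hp)) fun x hx => ?_
  have hO : vO x = 0 := by
    ext q
    by_cases hq : Even q.1.val
    · simp [vO, hx q (Nat.not_odd_iff_even.mpr hq)]
    · simp [vO, hq]
  ext p
  rcases Nat.even_or_odd p.1.val with hp | hp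
  · exact stairL_mulVec_of_even S x hp
  · rw [htri.stairL_mulVec_of_odd x hp, htri.mulVec_of_odd x hp, hO, Matrix.mulVec_zero,
      Pi.zero_apply, add_zero]
    exact blockDiagPart_mulVec_congr S fun a => by simp [vE, hp]

lemma isUnit_stairR {n m : ℕ} {S : Mat n m} (htri : IsBlockTridiag S)
    (hdiag : DiagBlocksInvertible S) : IsUnit (stairR S) := by
  refine hdiag.isUnit_of_splitting _ (fun i => Even i.val)
    (fun x p hp => stairR_mulVec_of_odd S x (Nat.not_even_iff_odd.mp hp)) fun x hx => ?_
  have hE : vE x = 0 := by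
    ext q
    by_cases hq : Odd q.1.val
    · simp [vE, hx q (Nat.not_even_iff_odd.mpr hq)]
    · simp [vE, hq]
  ext p
  rcases Nat.even_or_odd p.1.val with hp | hp
  · rw [htri.stairR_mulVec_of_even x hp, htri.mulVec_of_even x hp, hE, Matrix.mulVec_zero,
      Pi.zero_apply, add_zero]
    exact blockDiagPart_mulVec_congr S fun a => by simp [vO, hp]
  · exact stairR_mulVec_of_odd S x hp

lemma inv_mul_mulVec_eq_iff {ι : Type*} [Fintype ι] [DecidableEq ι] {A B : Matrix ι ι ℝ}
    (hA : IsUnit A) (x y : ι → ℝ) : (A⁻¹ * B) *ᵥ x = y ↔ B *ᵥ x = A *ᵥ y := by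
  have hdet := (Matrix.isUnit_iff_isUnit_det A).mp hA
  constructor
  · rintro rfl
    rw [Matrix.mulVec_mulVec, Matrix.mul_nonsing_inv_cancel_left _ _ hdet]
  · intro h
    rw [← Matrix.mulVec_mulVec, h, Matrix.mulVec_mulVec, Matrix.nonsing_inv_mul _ hdet,
      Matrix.one_mulVec]

lemma vE_vE_add_smul_vO {n m : ℕ} (c : ℝ) (v : Vec n m) : vE (vE v + c • vO v) = vE v := by
  ext p
  by_cases hp : Odd p.1.val
  · simp [vE, vO, hp, Nat.not_even_iff_odd.mpr hp]
  · simp [vE, hp]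

lemma vO_vE_add_smul_vO {n m : ℕ} (c : ℝ) (v : Vec n m) : vO (vE v + c • vO v) = c • vO v := by
  ext p
  by_cases hp : Even p.1.val
  · simp [vE, vO, hp, Nat.not_odd_iff_even.mpr hp]
  · simp [vO, hp]

/-- If (λ, v) is an eigenpair of Ψl⁻¹ * Pl with λ ≠ 0, then
(λ, v_e + λ • v_o) is an eigenpair of Ψr⁻¹ * Pr. -/
theorem eigenpair_left_to_right {n m : ℕ} (hn : 0 < n) (hm : 0 < m)
    (S : Mat n m) (hsymm : S.IsSymm) (htri : IsBlockTridiag S)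
    (hdiag : DiagBlocksInvertible S)
    (lam : ℝ) (v : Vec n m) (hv : v ≠ 0)
    (heig : ((stairL S)⁻¹ * Pl S) *ᵥ v = lam • v) (hlam : lam ≠ 0) :
    vE v + lam • vO v ≠ 0 ∧
      ((stairR S)⁻¹ * Pr S) *ᵥ (vE v + lam • vO v) = lam • (vE v + lam • vO v) := by
  refine ⟨fun h => hv ?_, ?_⟩
  · ext p
    have hp := congrFun h p
    rcases Nat.even_or_odd p.1.val with h' | h'
    · simpa [vE, vO, h', Nat.not_odd_iff_even.mpr h', hlam] using hp
    · simpa [vE, vO, h', Nat.not_even_iff_odd.mpr h'] using hp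
  rw [inv_mul_mulVec_eq_iff (isUnit_stairL htri hdiag)] at heig
  rw [inv_mul_mulVec_eq_iff (isUnit_stairR htri hdiag)]
  ext p
  have hp := congrFun heig p
  simp only [Pl, Matrix.sub_mulVec, Matrix.mulVec_smul, Pi.sub_apply, Pi.smul_apply,
    smul_eq_mul] at hp
  simp only [Pr, Matrix.sub_mulVec, Matrix.mulVec_smul, Pi.sub_apply,
    Pi.smul_apply, smul_eq_mul]
  rcases Nat.even_or_odd p.1.val with h | h
  · have hD : (blockDiagPart S *ᵥ v) p = (blockDiagPart S *ᵥ vO v) p :=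
      blockDiagPart_mulVec_congr S fun a => by simp [vO, h]
    rw [stairL_mulVec_of_even S v h, htri.mulVec_of_even v h, hD] at hp
    rw [htri.stairR_mulVec_of_even _ h, htri.mulVec_of_even _ h, vE_vE_add_smul_vO,
      vO_vE_add_smul_vO, Matrix.mulVec_smul, Pi.smul_apply, smul_eq_mul]
    linear_combination lam * hp
  · have hD : (blockDiagPart S *ᵥ (vE v + lam • vO v)) p = (blockDiagPart S *ᵥ vE v) p :=
      blockDiagPart_mulVec_congr S fun a => by simp [vO, Nat.not_even_iff_odd.mpr h]
    rw [htri.stairL_mulVec_of_odd v h, htri.mulVec_of_odd v h] at hp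
    rw [stairR_mulVec_of_odd S _ h, htri.mulVec_of_odd _ h, hD, vE_vE_add_smul_vO,
      vO_vE_add_smul_vO, Matrix.mulVec_smul, Pi.smul_apply, smul_eq_mul]
    linear_combination hp

end StairPrecond
end

section
/- If S is a symmetric block tridiagonal matrix that is positive definite, then every complex eigenvalue of Φsym⁻¹ * S (every root of the characteristic polynomial of Φsym⁻¹ * S over ℂ) is a real number. -/
open Matrix

namespace StairPrecond

theorem transpose_stairL {n m : ℕ} {S : Mat n m} (hS : Sᵀ = S) : (stairL S)ᵀ = stairR S := by
  ext p q
  have h : S q p = S p q := congrFun (congrFun hS p) q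
  simp only [transpose_apply, stairL, stairR, h, Fin.ext_iff]
  congr 1
  grind

theorem transpose_blockDiagPart {n m : ℕ} {S : Mat n m} (hS : Sᵀ = S) :
    (blockDiagPart S)ᵀ = blockDiagPart S := by
  ext p q
  have h : S q p = S p q := congrFun (congrFun hS p) q
  simp only [transpose_apply, blockDiagPart, h, eq_comm]

theorem transpose_Phisym {n m : ℕ} {S : Mat n m} (hS : Sᵀ = S) : (Phisym S)ᵀ = Phisym S := by
  have hR : (stairR S)ᵀ = stairL S := by rw [← transpose_stairL hS, transpose_transpose]
  rw [Phisym, transpose_sub, transpose_add, transpose_nonsing_inv, transpose_nonsing_inv,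
    transpose_nonsing_inv, transpose_stairL hS, hR, transpose_blockDiagPart hS, add_comm]

/-- Complex roots of the characteristic polynomial of a real symmetric matrix are real. -/
theorem im_eq_zero_of_isRoot_charpoly {ι : Type*} [Fintype ι] [DecidableEq ι]
    {M : Matrix ι ι ℝ} (hM : M.IsHermitian) {μ : ℂ}
    (hμ : (M.charpoly.map Complex.ofRealHom).IsRoot μ) : μ.im = 0 := by
  rw [hM.charpoly_eq, Polynomial.IsRoot, Polynomial.eval_map, Polynomial.eval₂_finsetProd,
    Finset.prod_eq_zero_iff] at hμ
  obtain ⟨i, -, hi⟩ := hμ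
  have h : μ = (hM.eigenvalues i : ℂ) := by simpa [sub_eq_zero] using hi
  rw [h, Complex.ofReal_im]

/-- If S is symmetric block tridiagonal positive definite, then every complex
eigenvalue of Φsym⁻¹ * S is real. -/
theorem sym_eigenvalues_real {n m : ℕ} (hn : 0 < n) (hm : 0 < m)
    (S : Mat n m) (htri : IsBlockTridiag S) (hpd : S.PosDef) :
    ∀ μ : ℂ, (Matrix.charpoly ((Phisym S * S).map (fun x => (x : ℂ)))).IsRoot μ →
      μ.im = 0 := by
  intro μ hμ
  have hS : Sᵀ = S := by simpa [IsHermitian, conjTranspose_eq_transpose_of_trivial] using hpd.1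
  obtain ⟨B, hB⟩ : ∃ B : Mat n m, S = Bᵀ * B := by
    open scoped MatrixOrder in
    obtain ⟨B, hB⟩ := CStarAlgebra.nonneg_iff_eq_star_mul_self.mp hpd.posSemidef.nonneg
    exact ⟨B, by simpa [star_eq_conjTranspose, conjTranspose_eq_transpose_of_trivial] using hB⟩
  have hM : (B * (Phisym S * Bᵀ)).IsHermitian := by
    rw [IsHermitian, conjTranspose_eq_transpose_of_trivial]
    simp [transpose_mul, transpose_Phisym hS, Matrix.mul_assoc]
  have hchar : (Phisym S * S).charpoly = (B * (Phisym S * Bᵀ)).charpoly := by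
    rw [charpoly_mul_comm B, Matrix.mul_assoc, ← hB]
  refine im_eq_zero_of_isRoot_charpoly hM ?_
  rw [← hchar, ← charpoly_map]
  exact hμ

end StairPrecond
end

section
/- If S is a symmetric block tridiagonal matrix that is positive definite, then every complex eigenvalue μ of the matrix 1 − Φsym⁻¹ * S (the identity minus the symmetric-stair preconditioned matrix) is real and satisfies 0 ≤ μ < 1; in particular the spectral radius of 1 − Φsym⁻¹ * S is strictly less than 1, so the symmetric stair splitting is convergent. -/
open Matrix

namespace StairPrecond

/-- A complex eigenvalue of a real matrix `M` with `D * M = E`, where `E` is positive semidefinite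
and both `D` and `D - E` are positive definite, lies in `[0, 1)`. -/
theorem isRoot_charpoly_map_mem_Ico {ι : Type*} [Fintype ι] [DecidableEq ι]
    {D E M : Matrix ι ι ℝ} (hD : D.PosDef) (hE : E.PosSemidef) (hDE : (D - E).PosDef)
    (hM : D * M = E) {μ : ℂ}
    (hμ : (Matrix.charpoly (M.map (fun x => (x : ℂ)))).IsRoot μ) :
    μ.im = 0 ∧ 0 ≤ μ.re ∧ μ.re < 1 := by
  rw [Polynomial.IsRoot.def, Matrix.eval_charpoly, ← Matrix.exists_mulVec_eq_zero_iff] at hμ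
  obtain ⟨v, hv, h⟩ := hμ
  set x : ι → ℝ := fun i => (v i).re with hx
  set y : ι → ℝ := fun i => (v i).im with hy
  have key : ∀ i, ∑ j, (M i j : ℂ) * v j = μ * v i := by
    intro i
    have h1 := congrFun h i
    rw [Matrix.sub_mulVec, Pi.sub_apply, Matrix.scalar_apply, Matrix.mulVec_diagonal,
      Pi.zero_apply, sub_eq_zero] at h1
    rw [h1]
    simp [Matrix.mulVec, dotProduct]
  have hMx : M *ᵥ x = μ.re • x - μ.im • y := by
    ext i
    have h1 := congrArg Complex.re (key i)
    simpa [Matrix.mulVec, dotProduct, hx, hy] using h1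
  have hMy : M *ᵥ y = μ.re • y + μ.im • x := by
    ext i
    have h1 := congrArg Complex.im (key i)
    simpa [Matrix.mulVec, dotProduct, hx, hy] using h1
  have hEx : E *ᵥ x = μ.re • (D *ᵥ x) - μ.im • (D *ᵥ y) := by
    rw [← hM, ← Matrix.mulVec_mulVec, hMx, Matrix.mulVec_sub, Matrix.mulVec_smul,
      Matrix.mulVec_smul]
  have hEy : E *ᵥ y = μ.re • (D *ᵥ y) + μ.im • (D *ᵥ x) := by
    rw [← hM, ← Matrix.mulVec_mulVec, hMy, Matrix.mulVec_add, Matrix.mulVec_smul,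
      Matrix.mulVec_smul]
  have symm_form : ∀ {F : Matrix ι ι ℝ}, F.IsHermitian → y ⬝ᵥ F *ᵥ x = x ⬝ᵥ F *ᵥ y := by
    intro F hF
    have hF' : Fᵀ = F := by simpa using hF.eq
    rw [dotProduct_comm, ← Matrix.vecMul_transpose, hF', ← Matrix.dotProduct_mulVec]
  have nonneg : ∀ {F : Matrix ι ι ℝ}, F.PosSemidef → ∀ z, 0 ≤ z ⬝ᵥ F *ᵥ z := fun hF z => by
    simpa using hF.dotProduct_mulVec_nonneg z
  have pos : ∀ {F : Matrix ι ι ℝ}, F.PosDef → ∀ z, z ≠ 0 → 0 < z ⬝ᵥ F *ᵥ z := fun hF z hz => by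
    simpa using hF.dotProduct_mulVec_pos hz
  have pos_add : ∀ {F : Matrix ι ι ℝ}, F.PosDef → 0 < x ⬝ᵥ F *ᵥ x + y ⬝ᵥ F *ᵥ y := by
    intro F hF
    have hxy : x ≠ 0 ∨ y ≠ 0 := by
      by_contra! hc
      exact hv (funext fun i => Complex.ext (congrFun hc.1 i) (congrFun hc.2 i))
    rcases hxy with hz | hz
    · exact add_pos_of_pos_of_nonneg (pos hF _ hz) (nonneg hF.posSemidef _)
    · exact add_pos_of_nonneg_of_pos (nonneg hF.posSemidef _) (pos hF _ hz)
  have hd := pos_add hD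
  have hde := pos_add hDE
  have he := add_nonneg (nonneg hE x) (nonneg hE y)
  have hsE := symm_form hE.isHermitian
  have hsD := symm_form hD.isHermitian
  simp only [Matrix.sub_mulVec, dotProduct_sub] at hde
  simp only [hEx, hEy, dotProduct_sub, dotProduct_add, dotProduct_smul, smul_eq_mul]
    at hsE he hde
  rw [hsD] at hsE he hde
  have him : μ.im * (x ⬝ᵥ D *ᵥ x + y ⬝ᵥ D *ᵥ y) = 0 := by linarith
  have him0 : μ.im = 0 := (mul_eq_zero.mp him).resolve_right hd.ne'
  refine ⟨him0, ?_, ?_⟩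
  · exact nonneg_of_mul_nonneg_left (b := x ⬝ᵥ D *ᵥ x + y ⬝ᵥ D *ᵥ y) (by linarith) hd
  · have : 0 < (1 - μ.re) * (x ⬝ᵥ D *ᵥ x + y ⬝ᵥ D *ᵥ y) := by linarith
    linarith [pos_of_mul_pos_left this hd.le]

/-- If `K` is a right inverse of `D` and `A * K * A = 0`, then `K - K * A * K` is a right inverse
of `D + A`. -/
theorem add_mul_sub_mul_mul_eq_one {R : Type*} [Ring R] {A D K : R}
    (hDK : D * K = 1) (h : A * K * A = 0) :
    (D + A) * (K - K * A * K) = 1 := by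
  calc (D + A) * (K - K * A * K)
      = D * K + A * K - (D * K) * A * K - (A * K * A) * K := by noncomm_ring
    _ = 1 := by rw [h, hDK]; noncomm_ring

/-- If `J` commutes with `K`, negates `A` on the left and fixes it on the right, then
`A * K * A = 0`. -/
theorem mul_mul_self_eq_zero {R : Type*} [Ring R] [Module ℝ R] {J A K : R}
    (hJK : J * K = K * J) (hJA : J * A = -A) (hAJ : A * J = A) : A * K * A = 0 := by
  have h : A * K * A = -(A * K * A) := by
    calc A * K * A = A * J * K * A := by rw [hAJ]
      _ = A * K * (J * A) := by
        rw [mul_assoc A J K, hJK, ← mul_assoc A K J, mul_assoc (A * K) J A]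
      _ = -(A * K * A) := by rw [hJA, mul_neg]
  have h2 : (2 : ℝ) • (A * K * A) = 0 := by
    rw [two_smul]
    nth_rewrite 1 [h]
    exact neg_add_cancel _
  exact (smul_eq_zero_iff_right two_ne_zero).mp h2

/-- `D - N * D⁻¹ * N` is positive definite when `D + N` and `D - N` are. -/
theorem posDef_sub_mul_inv_mul {ι : Type*} [Fintype ι] [DecidableEq ι]
    {D N : Matrix ι ι ℝ} (hD : D.PosDef)
    (hadd : (D + N).PosDef) (hsub : (D - N).PosDef) : (D - N * D⁻¹ * N).PosDef := by
  have hDK : D * D⁻¹ = 1 := Matrix.mul_nonsing_inv _ ((Matrix.isUnit_iff_isUnit_det _).mp hD.isUnit)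
  have hKD : D⁻¹ * D = 1 := Matrix.nonsing_inv_mul _ ((Matrix.isUnit_iff_isUnit_det _).mp hD.isUnit)
  have hK : (D⁻¹)ᴴ = D⁻¹ := hD.inv.isHermitian.eq
  have h1 := hadd.conjTranspose_mul_mul_same (B := D⁻¹ * (D - N))
    (Matrix.mulVec_injective_of_isUnit (hD.inv.isUnit.mul hsub.isUnit))
  have h2 := hsub.conjTranspose_mul_mul_same (B := D⁻¹ * (D + N))
    (Matrix.mulVec_injective_of_isUnit (hD.inv.isUnit.mul hadd.isUnit))
  rw [Matrix.conjTranspose_mul, hK, hsub.isHermitian.eq] at h1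
  rw [Matrix.conjTranspose_mul, hK, hadd.isHermitian.eq] at h2
  have h3 := (h1.add h2).smul (show (0 : ℝ) < 1 / 2 by norm_num)
  convert h3 using 1
  have e1 : (D - N) * D⁻¹ = 1 - N * D⁻¹ := by rw [Matrix.sub_mul, hDK]
  have e2 : D⁻¹ * (D - N) = 1 - D⁻¹ * N := by rw [Matrix.mul_sub, hKD]
  have e3 : (D + N) * D⁻¹ = 1 + N * D⁻¹ := by rw [Matrix.add_mul, hDK]
  have e4 : D⁻¹ * (D + N) = 1 + D⁻¹ * N := by rw [Matrix.mul_add, hKD]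
  have f1 : (1 - N * D⁻¹) * (D + N) = D - N * D⁻¹ * N := by
    calc _ = D + N - N * (D⁻¹ * D) - N * D⁻¹ * N := by noncomm_ring
      _ = _ := by rw [hKD]; noncomm_ring
  have f2 : (1 + N * D⁻¹) * (D - N) = D - N * D⁻¹ * N := by
    calc _ = D - N + N * (D⁻¹ * D) - N * D⁻¹ * N := by noncomm_ring
      _ = _ := by rw [hKD]; noncomm_ring
  rw [e1, e2, e3, e4, f1, f2, ← Matrix.mul_add]
  have f3 : (1 - D⁻¹ * N) + (1 + D⁻¹ * N) = (2 : ℝ) • (1 : Matrix ι ι ℝ) := by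
    rw [two_smul]; abel
  rw [f3, Matrix.mul_smul, smul_smul, Matrix.mul_one]
  norm_num

/-- The diagonal matrix with entry `1` on even and `-1` on odd block rows. -/
def paritySign (n m : ℕ) : Mat n m := Matrix.diagonal fun p => (-1) ^ p.1.val

theorem paritySign_mul_self (n m : ℕ) : paritySign n m * paritySign n m = 1 := by
  rw [paritySign, Matrix.diagonal_mul_diagonal, ← Matrix.diagonal_one]
  congr 1
  ext p
  rw [← mul_pow]
  simp

theorem paritySign_mul_blockDiagPart {n m : ℕ} (S : Mat n m) :
    paritySign n m * blockDiagPart S = blockDiagPart S * paritySign n m := by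
  ext p q
  rw [paritySign, Matrix.diagonal_mul, Matrix.mul_diagonal, blockDiagPart]
  split_ifs with h
  · rw [h, mul_comm]
  · simp

theorem stairL_sub_blockDiagPart_apply {n m : ℕ} (S : Mat n m) (p q : Fin n × Fin m) :
    (stairL S - blockDiagPart S) p q =
      if Odd p.1.val ∧ (p.1.val = q.1.val + 1 ∨ q.1.val = p.1.val + 1) then S p q else 0 := by
  simp only [Matrix.sub_apply, stairL, blockDiagPart, Fin.ext_iff]
  grind

theorem stairR_sub_blockDiagPart_apply {n m : ℕ} (S : Mat n m) (p q : Fin n × Fin m) :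
    (stairR S - blockDiagPart S) p q =
      if Even p.1.val ∧ (p.1.val = q.1.val + 1 ∨ q.1.val = p.1.val + 1) then S p q else 0 := by
  simp only [Matrix.sub_apply, stairR, blockDiagPart, Fin.ext_iff]
  grind

theorem paritySign_mul_stairL_sub {n m : ℕ} (S : Mat n m) :
    paritySign n m * (stairL S - blockDiagPart S) = -(stairL S - blockDiagPart S) := by
  ext p q
  rw [paritySign, Matrix.diagonal_mul, Matrix.neg_apply, stairL_sub_blockDiagPart_apply]
  split_ifs with h
  · rw [h.1.neg_one_pow, neg_one_mul]
  · simp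

theorem stairL_sub_mul_paritySign {n m : ℕ} (S : Mat n m) :
    (stairL S - blockDiagPart S) * paritySign n m = stairL S - blockDiagPart S := by
  ext p q
  rw [paritySign, Matrix.mul_diagonal, stairL_sub_blockDiagPart_apply]
  split_ifs with h
  · have : Even q.1.val := by grind
    rw [this.neg_one_pow, mul_one]
  · simp

theorem paritySign_mul_stairR_sub {n m : ℕ} (S : Mat n m) :
    paritySign n m * (stairR S - blockDiagPart S) = stairR S - blockDiagPart S := by
  ext p q
  rw [paritySign, Matrix.diagonal_mul, stairR_sub_blockDiagPart_apply]
  split_ifs with h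
  · rw [h.1.neg_one_pow, one_mul]
  · simp

theorem stairR_sub_mul_paritySign {n m : ℕ} (S : Mat n m) :
    (stairR S - blockDiagPart S) * paritySign n m = -(stairR S - blockDiagPart S) := by
  ext p q
  rw [paritySign, Matrix.mul_diagonal, Matrix.neg_apply, stairR_sub_blockDiagPart_apply]
  split_ifs with h
  · have : Odd q.1.val := by grind
    rw [this.neg_one_pow, mul_neg_one]
  · simp

theorem sub_blockDiagPart_eq {n m : ℕ} {S : Mat n m} (htri : IsBlockTridiag S) :
    S - blockDiagPart S = (stairL S - blockDiagPart S) + (stairR S - blockDiagPart S) := by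
  ext p q
  rw [Matrix.add_apply, stairL_sub_blockDiagPart_apply, stairR_sub_blockDiagPart_apply,
    Matrix.sub_apply, blockDiagPart]
  have h0 : (p.1.val + 1 < q.1.val ∨ q.1.val + 1 < p.1.val) → S p q = 0 := fun h =>
    congrFun (congrFun (htri p.1 q.1 h) p.2) q.2
  simp only [Fin.ext_iff]
  rcases Nat.even_or_odd p.1.val with hp | hp
  · have := Nat.not_odd_iff_even.mpr hp
    grind
  · have := Nat.not_even_iff_odd.mpr hp
    grind

/-- Conjugating by the parity signs flips the sign of the off-diagonal blocks. -/
theorem paritySign_mul_mul_paritySign {n m : ℕ} {S : Mat n m} (htri : IsBlockTridiag S) :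
    paritySign n m * S * paritySign n m = blockDiagPart S - (S - blockDiagPart S) := by
  have h : S = blockDiagPart S + ((stairL S - blockDiagPart S) + (stairR S - blockDiagPart S)) := by
    rw [← sub_blockDiagPart_eq htri]; abel
  rw [sub_blockDiagPart_eq htri]
  conv_lhs => rw [h]
  rw [Matrix.mul_add, Matrix.mul_add, paritySign_mul_blockDiagPart, paritySign_mul_stairL_sub,
    paritySign_mul_stairR_sub, Matrix.add_mul, Matrix.add_mul, Matrix.mul_assoc,
    paritySign_mul_self, Matrix.neg_mul, stairL_sub_mul_paritySign, stairR_sub_mul_paritySign,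
    Matrix.mul_one]
  abel

theorem posDef_blockDiagPart_sub {n m : ℕ} {S : Mat n m} (htri : IsBlockTridiag S)
    (hpd : S.PosDef) : (blockDiagPart S - (S - blockDiagPart S)).PosDef := by
  have hJ : IsUnit (paritySign n m) :=
    IsUnit.of_mul_eq_one _ (paritySign_mul_self n m)
  have h := hpd.conjTranspose_mul_mul_same (Matrix.mulVec_injective_of_isUnit hJ)
  have hJt : (paritySign n m)ᴴ = paritySign n m := by
    simp [paritySign]
  rwa [hJt, paritySign_mul_mul_paritySign htri] at h

theorem posDef_blockDiagPart {n m : ℕ} {S : Mat n m} (htri : IsBlockTridiag S)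
    (hpd : S.PosDef) : (blockDiagPart S).PosDef := by
  have h := (hpd.add (posDef_blockDiagPart_sub htri hpd)).smul
    (show (0 : ℝ) < 1 / 2 by norm_num)
  convert h using 1
  ext p q
  simp only [Matrix.smul_apply, Matrix.add_apply, Matrix.sub_apply, smul_eq_mul]
  ring

theorem paritySign_mul_blockDiagPart_inv {n m : ℕ} {S : Mat n m}
    (hD : IsUnit (blockDiagPart S)) :
    paritySign n m * (blockDiagPart S)⁻¹ = (blockDiagPart S)⁻¹ * paritySign n m := by
  have hDK := Matrix.mul_nonsing_inv _ ((Matrix.isUnit_iff_isUnit_det _).mp hD)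
  have hKD := Matrix.nonsing_inv_mul _ ((Matrix.isUnit_iff_isUnit_det _).mp hD)
  calc paritySign n m * (blockDiagPart S)⁻¹
      = (blockDiagPart S)⁻¹ * (blockDiagPart S * paritySign n m) * (blockDiagPart S)⁻¹ := by
        rw [← Matrix.mul_assoc, hKD, Matrix.one_mul]
    _ = (blockDiagPart S)⁻¹ * paritySign n m := by
        rw [← paritySign_mul_blockDiagPart, Matrix.mul_assoc, Matrix.mul_assoc, hDK,
          Matrix.mul_one]

theorem stairL_inv {n m : ℕ} {S : Mat n m} (hD : IsUnit (blockDiagPart S)) :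
    (stairL S)⁻¹ = (blockDiagPart S)⁻¹ -
      (blockDiagPart S)⁻¹ * (stairL S - blockDiagPart S) * (blockDiagPart S)⁻¹ := by
  have hDK := Matrix.mul_nonsing_inv _ ((Matrix.isUnit_iff_isUnit_det _).mp hD)
  refine Matrix.inv_eq_right_inv ?_
  have h := add_mul_sub_mul_mul_eq_one (A := stairL S - blockDiagPart S) hDK ?_
  · rwa [add_sub_cancel] at h
  · exact mul_mul_self_eq_zero (paritySign_mul_blockDiagPart_inv hD)
      (paritySign_mul_stairL_sub S) (stairL_sub_mul_paritySign S)

theorem stairR_inv {n m : ℕ} {S : Mat n m} (hD : IsUnit (blockDiagPart S)) :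
    (stairR S)⁻¹ = (blockDiagPart S)⁻¹ -
      (blockDiagPart S)⁻¹ * (stairR S - blockDiagPart S) * (blockDiagPart S)⁻¹ := by
  have hDK := Matrix.mul_nonsing_inv _ ((Matrix.isUnit_iff_isUnit_det _).mp hD)
  refine Matrix.inv_eq_right_inv ?_
  have h := add_mul_sub_mul_mul_eq_one (A := stairR S - blockDiagPart S) hDK ?_
  · rwa [add_sub_cancel] at h
  · refine mul_mul_self_eq_zero (J := -paritySign n m) ?_ ?_ ?_
    · rw [neg_mul, mul_neg, paritySign_mul_blockDiagPart_inv hD]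
    · rw [neg_mul, paritySign_mul_stairR_sub]
    · rw [mul_neg, stairR_sub_mul_paritySign, neg_neg]

theorem Phisym_eq {n m : ℕ} {S : Mat n m} (htri : IsBlockTridiag S)
    (hD : IsUnit (blockDiagPart S)) :
    Phisym S = (blockDiagPart S)⁻¹ -
      (blockDiagPart S)⁻¹ * (S - blockDiagPart S) * (blockDiagPart S)⁻¹ := by
  rw [Phisym, stairL_inv hD, stairR_inv hD, sub_blockDiagPart_eq htri, Matrix.mul_add,
    Matrix.add_mul]
  abel

theorem blockDiagPart_mul_one_sub_Phisym_mul {n m : ℕ} {S : Mat n m} (htri : IsBlockTridiag S)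
    (hD : IsUnit (blockDiagPart S)) :
    blockDiagPart S * (1 - Phisym S * S) =
      (S - blockDiagPart S) * (blockDiagPart S)⁻¹ * (S - blockDiagPart S) := by
  have hDK := Matrix.mul_nonsing_inv _ ((Matrix.isUnit_iff_isUnit_det _).mp hD)
  have hKD := Matrix.nonsing_inv_mul _ ((Matrix.isUnit_iff_isUnit_det _).mp hD)
  rw [Phisym_eq htri hD]
  generalize (blockDiagPart S)⁻¹ = K at *
  generalize blockDiagPart S = D at *
  calc D * (1 - (K - K * (S - D) * K) * S)
      = D - (D * K) * S + (D * K) * (S - D) * K * S := by noncomm_ring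
    _ = (S - D) * K * S - (S - D) * (K * D) := by rw [hDK, hKD]; noncomm_ring
    _ = (S - D) * K * (S - D) := by noncomm_ring

/-- If S is symmetric block tridiagonal positive definite, then every complex
eigenvalue μ of 1 − Φsym⁻¹ * S is real with 0 ≤ μ < 1; in particular the spectral
radius of 1 − Φsym⁻¹ * S is strictly less than 1. -/
theorem sym_splitting_convergent {n m : ℕ} (hn : 0 < n) (hm : 0 < m)
    (S : Mat n m) (htri : IsBlockTridiag S) (hpd : S.PosDef) :
    ∀ μ : ℂ, (Matrix.charpoly ((1 - Phisym S * S).map (fun x => (x : ℂ)))).IsRoot μ →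
      μ.im = 0 ∧ 0 ≤ μ.re ∧ μ.re < 1 := by
  intro μ hμ
  have hD := posDef_blockDiagPart htri hpd
  have hN : (S - blockDiagPart S).IsHermitian := hpd.isHermitian.sub hD.isHermitian
  refine isRoot_charpoly_map_mem_Ico hD ?_ ?_
    (blockDiagPart_mul_one_sub_Phisym_mul htri hD.isUnit) hμ
  · have h := hD.inv.posSemidef.conjTranspose_mul_mul_same (S - blockDiagPart S)
    rwa [hN.eq] at h
  · refine posDef_sub_mul_inv_mul hD ?_ (posDef_blockDiagPart_sub htri hpd)
    rwa [add_sub_cancel]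

end StairPrecond
end

section
/- Let S be a symmetric block tridiagonal positive definite matrix and suppose λ ∈ (0, 1) is an eigenvalue of Ψl⁻¹ * Pl. Then 1 − λ is an eigenvalue of Φsym⁻¹ * S, both 1 − (λ + √λ)/2 and 1 − (λ − √λ)/2 are eigenvalues of Φadd⁻¹ * S, and the inequalities 1 − (λ − √λ)/2 > 1 and 1 − (λ + √λ)/2 < 1 − λ hold; in particular Φadd⁻¹ * S has an eigenvalue strictly greater than every eigenvalue of Φsym⁻¹ * S (all of which are at most 1) and an eigenvalue strictly smaller than the eigenvalue 1 − λ of Φsym⁻¹ * S. -/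
open Matrix

namespace StairPrecond

/-- The diagonal projector onto the blocks of odd index. -/
def oddProj (n m : ℕ) : Mat n m :=
  Matrix.diagonal fun p => if Odd p.1.val then 1 else 0

lemma isUnit_blockDiagPart {n m : ℕ} {S : Mat n m} (hpd : S.PosDef) :
    IsUnit (blockDiagPart S) := by
  rw [← Matrix.mulVec_injective_iff_isUnit, ← Matrix.coe_mulVecLin,
    ← LinearMap.ker_eq_bot, LinearMap.ker_eq_bot']
  intro x hx
  rw [Matrix.mulVecLin_apply] at hx
  funext p
  let y : Vec n m := fun q => if q.1 = p.1 then x q else 0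
  have hy : y = 0 := by
    by_contra hne
    have hpos := hpd.dotProduct_mulVec_pos hne
    have hzero : star y ⬝ᵥ (S *ᵥ y) = 0 := by
      refine Finset.sum_eq_zero fun r _ => ?_
      by_cases hr : r.1 = p.1
      · have hrow : (S *ᵥ y) r = (blockDiagPart S *ᵥ x) r := by
          refine Finset.sum_congr rfl fun q _ => ?_
          by_cases hq : q.1 = p.1 <;> simp [y, blockDiagPart, hr, hq, eq_comm]
        rw [hrow, hx]
        simp
      · simp [y, hr]
    exact hpos.ne' hzero
  simpa [y] using congrFun hy p

lemma blockDiagPart_mul_oddProj {n m : ℕ} (S : Mat n m) :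
    blockDiagPart S * oddProj n m = oddProj n m * blockDiagPart S := by
  ext p q
  rw [oddProj, Matrix.mul_diagonal, Matrix.diagonal_mul]
  by_cases h : p.1 = q.1 <;> simp [blockDiagPart, h]

lemma oddProj_mul_stairL_sub {n m : ℕ} (S : Mat n m) :
    oddProj n m * (stairL S - blockDiagPart S) = stairL S - blockDiagPart S := by
  ext p q
  rw [oddProj, Matrix.diagonal_mul]
  by_cases h : p.1 = q.1 <;> by_cases ho : Odd p.1.val <;>
    simp [stairL, blockDiagPart, h, ho]

lemma stairL_sub_mul_oddProj {n m : ℕ} (S : Mat n m) :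
    (stairL S - blockDiagPart S) * oddProj n m = 0 := by
  ext p q
  rw [oddProj, Matrix.mul_diagonal]
  simp only [stairL, blockDiagPart, Matrix.sub_apply, Matrix.zero_apply]
  grind

lemma oddProj_mul_stairR_sub {n m : ℕ} (S : Mat n m) :
    oddProj n m * (stairR S - blockDiagPart S) = 0 := by
  ext p q
  rw [oddProj, Matrix.diagonal_mul]
  simp only [stairR, blockDiagPart, Matrix.sub_apply, Matrix.zero_apply]
  grind

lemma stairR_sub_mul_oddProj {n m : ℕ} (S : Mat n m) :
    (stairR S - blockDiagPart S) * oddProj n m = stairR S - blockDiagPart S := by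
  ext p q
  rw [oddProj, Matrix.mul_diagonal]
  simp only [stairR, blockDiagPart, Matrix.sub_apply]
  grind

/-- A block tridiagonal matrix is `Ψl + Ψr - D`. -/
lemma IsBlockTridiag.eq_stairL_add_stairR_sub {n m : ℕ} {S : Mat n m}
    (htri : IsBlockTridiag S) : S = stairL S + stairR S - blockDiagPart S := by
  ext p q
  have h0 : p.1.val + 1 < q.1.val ∨ q.1.val + 1 < p.1.val → S p q = 0 := fun h =>
    congrFun (congrFun (htri p.1 q.1 h) p.2) q.2
  simp only [stairL, stairR, blockDiagPart, Matrix.sub_apply, Matrix.add_apply]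
  by_cases h : p.1 = q.1
  · simp [h]
  · have hv : p.1.val ≠ q.1.val := fun he => h (Fin.ext he)
    grind

/-- If `Q` commutes with the invertible matrix `D` and `N` maps the kernel of `Q` to its range
(or the reverse), then `D⁻¹ * N` squares to zero. -/
lemma inv_mul_sq_eq_zero {ι : Type*} [Fintype ι] [DecidableEq ι] {D N Q : Matrix ι ι ℝ}
    (hD : IsUnit D) (hDQ : D * Q = Q * D)
    (h : Q * N = N ∧ N * Q = 0 ∨ Q * N = 0 ∧ N * Q = N) :
    D⁻¹ * N * (D⁻¹ * N) = 0 := by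
  have hdet := (Matrix.isUnit_iff_isUnit_det D).1 hD
  have hinv : D⁻¹ * Q = Q * D⁻¹ := by
    calc D⁻¹ * Q = D⁻¹ * (Q * D) * D⁻¹ := by
          rw [Matrix.mul_assoc, Matrix.mul_assoc, Matrix.mul_nonsing_inv D hdet, Matrix.mul_one]
      _ = Q * D⁻¹ := by
          rw [← hDQ, ← Matrix.mul_assoc, Matrix.nonsing_inv_mul D hdet, Matrix.one_mul]
  have hmid : N * (D⁻¹ * N) = 0 := by
    rcases h with ⟨h1, h2⟩ | ⟨h1, h2⟩
    · calc N * (D⁻¹ * N) = N * (D⁻¹ * Q * N) := by rw [Matrix.mul_assoc D⁻¹, h1]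
        _ = N * Q * (D⁻¹ * N) := by rw [hinv]; simp only [Matrix.mul_assoc]
        _ = 0 := by rw [h2, Matrix.zero_mul]
    · calc N * (D⁻¹ * N) = N * Q * (D⁻¹ * N) := by rw [h2]
        _ = N * (D⁻¹ * Q * N) := by rw [hinv]; simp only [Matrix.mul_assoc]
        _ = 0 := by rw [Matrix.mul_assoc D⁻¹, h1]; simp
  rw [Matrix.mul_assoc, hmid, Matrix.mul_zero]

/-- The inverse of `D + N` when `D⁻¹ * N` squares to zero. -/
lemma add_inv_of_sq_eq_zero {ι : Type*} [Fintype ι] [DecidableEq ι] {D N : Matrix ι ι ℝ}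
    (hD : IsUnit D) (hN : D⁻¹ * N * (D⁻¹ * N) = 0) :
    (D + N)⁻¹ = (1 - D⁻¹ * N) * D⁻¹ := by
  have hdet := (Matrix.isUnit_iff_isUnit_det D).1 hD
  apply Matrix.inv_eq_left_inv
  rw [Matrix.mul_assoc, Matrix.mul_add, Matrix.nonsing_inv_mul D hdet]
  calc (1 - D⁻¹ * N) * (1 + D⁻¹ * N) = 1 - D⁻¹ * N * (D⁻¹ * N) := by noncomm_ring
    _ = 1 := by rw [hN, sub_zero]

/-- If `A` and `B` square to zero and `λ ≠ 0` is an eigenvalue of `A * B - B`, there is a nonzero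
`u` with `(A + B)² u = λ u` that is not an eigenvector of `A + B`. -/
lemma exists_sq_eigenvector {ι : Type*} [Fintype ι] [DecidableEq ι] {A B : Matrix ι ι ℝ}
    (hA : A * A = 0) (hB : B * B = 0) {lam : ℝ} (hlam : lam ≠ 0)
    (hev : ∃ v : ι → ℝ, v ≠ 0 ∧ (A * B - B) *ᵥ v = lam • v) :
    ∃ u : ι → ℝ, u ≠ 0 ∧ (A + B) *ᵥ ((A + B) *ᵥ u) = lam • u ∧
      ∀ c : ℝ, (A + B) *ᵥ u + c • u ≠ 0 := by
  obtain ⟨v, hv, hvl⟩ := hev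
  have hBB : B *ᵥ (B *ᵥ v) = 0 := by rw [Matrix.mulVec_mulVec, hB, Matrix.zero_mulVec]
  have hu : B *ᵥ v ≠ 0 := by
    intro h
    rw [Matrix.sub_mulVec, ← Matrix.mulVec_mulVec, h, Matrix.mulVec_zero, sub_zero] at hvl
    exact (smul_ne_zero hlam hv) hvl.symm
  have hBA : B *ᵥ (A *ᵥ (B *ᵥ v)) = lam • (B *ᵥ v) := by
    have h := congrArg (B *ᵥ ·) hvl
    simpa [Matrix.sub_mulVec, Matrix.mulVec_sub, ← Matrix.mulVec_mulVec, hBB,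
      Matrix.mulVec_smul] using h
  have hT : (A + B) *ᵥ (B *ᵥ v) = A *ᵥ (B *ᵥ v) := by
    rw [Matrix.add_mulVec, hBB, add_zero]
  refine ⟨B *ᵥ v, hu, ?_, fun c hc => ?_⟩
  · rw [hT, Matrix.add_mulVec, hBA, Matrix.mulVec_mulVec _ A A, hA, Matrix.zero_mulVec, zero_add]
  · have h := congrArg (B *ᵥ ·) hc
    simp only [hT, Matrix.mulVec_add, Matrix.mulVec_smul, hBA, hBB, smul_zero, add_zero,
      Matrix.mulVec_zero] at h
    exact smul_ne_zero hlam hu h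

/-- With `T = D⁻¹ (S - D)`, the preconditioned matrices are `1 - T²` and `1 + (T - T²) / 2`, while
`Ψl⁻¹ Pl = A B - B` for a splitting `T = A + B` into square-zero parts. -/
lemma exists_splitting {n m : ℕ} {S : Mat n m} (htri : IsBlockTridiag S) (hpd : S.PosDef) :
    ∃ A B : Mat n m, A * A = 0 ∧ B * B = 0 ∧ (stairL S)⁻¹ * Pl S = A * B - B ∧
      Phisym S * S = 1 - (A + B) * (A + B) ∧
      Phiadd S * S = 1 + (1 / 2 : ℝ) • ((A + B) - (A + B) * (A + B)) := by
  have hD := isUnit_blockDiagPart hpd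
  have hcomm := blockDiagPart_mul_oddProj S
  have hA := inv_mul_sq_eq_zero hD hcomm
    (Or.inl ⟨oddProj_mul_stairL_sub S, stairL_sub_mul_oddProj S⟩)
  have hB := inv_mul_sq_eq_zero hD hcomm
    (Or.inr ⟨oddProj_mul_stairR_sub S, stairR_sub_mul_oddProj S⟩)
  have hL := add_inv_of_sq_eq_zero hD hA
  have hR := add_inv_of_sq_eq_zero hD hB
  rw [add_sub_cancel] at hL hR
  have hdet := (Matrix.isUnit_iff_isUnit_det _).1 hD
  have hDS : (blockDiagPart S)⁻¹ * S = 1 + (blockDiagPart S)⁻¹ * (stairL S - blockDiagPart S) +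
      (blockDiagPart S)⁻¹ * (stairR S - blockDiagPart S) := by
    have h := congrArg ((blockDiagPart S)⁻¹ * ·) htri.eq_stairL_add_stairR_sub
    refine h.trans ?_
    rw [← Matrix.nonsing_inv_mul _ hdet]
    noncomm_ring
  have hDP : (blockDiagPart S)⁻¹ * Pl S =
      -((blockDiagPart S)⁻¹ * (stairR S - blockDiagPart S)) := by
    have hP : Pl S = -(stairR S - blockDiagPart S) := by
      rw [Pl]
      refine (congrArg (stairL S - ·) htri.eq_stairL_add_stairR_sub).trans ?_
      abel
    rw [hP, Matrix.mul_neg]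
  generalize (blockDiagPart S)⁻¹ * (stairL S - blockDiagPart S) = A at *
  generalize (blockDiagPart S)⁻¹ * (stairR S - blockDiagPart S) = B at *
  have hLS : (stairL S)⁻¹ * S = 1 + B - A * B := by
    rw [hL, Matrix.mul_assoc, hDS]
    calc (1 - A) * (1 + A + B) = 1 + B - A * B - A * A := by noncomm_ring
      _ = 1 + B - A * B := by rw [hA, sub_zero]
  have hRS : (stairR S)⁻¹ * S = 1 + A - B * A := by
    rw [hR, Matrix.mul_assoc, hDS]
    calc (1 - B) * (1 + A + B) = 1 + A - B * A - B * B := by noncomm_ring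
      _ = 1 + A - B * A := by rw [hB, sub_zero]
  have hsq : (A + B) * (A + B) = A * B + B * A := by
    rw [Matrix.add_mul, Matrix.mul_add, Matrix.mul_add, hA, hB, zero_add, add_zero]
  refine ⟨A, B, hA, hB, ?_, ?_, ?_⟩
  · rw [hL, Matrix.mul_assoc, hDP]
    noncomm_ring
  · rw [Phisym, Matrix.sub_mul, Matrix.add_mul, hLS, hRS, hDS, hsq]
    abel
  · rw [Phiadd, Matrix.smul_mul, Matrix.add_mul, hLS, hRS, hsq]
    module

/-- A square root `s` of an eigenvalue of `T²` gives the eigenvector `T u + s u` of `T`, hence one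
of `1 + (T - T²) / 2`. -/
lemma eigenvector_of_sq_eigenvector {ι : Type*} [Fintype ι] [DecidableEq ι] {T : Matrix ι ι ℝ}
    {u : ι → ℝ} {s : ℝ} (hu : T *ᵥ (T *ᵥ u) = (s * s) • u) :
    (1 + (1 / 2 : ℝ) • (T - T * T)) *ᵥ (T *ᵥ u + s • u) =
      (1 - (s * s - s) / 2) • (T *ᵥ u + s • u) := by
  have hT : T *ᵥ (T *ᵥ u + s • u) = s • (T *ᵥ u + s • u) := by
    rw [Matrix.mulVec_add, hu, Matrix.mulVec_smul]
    module
  rw [Matrix.add_mulVec, Matrix.one_mulVec, Matrix.smul_mulVec, Matrix.sub_mulVec,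
    ← Matrix.mulVec_mulVec, hT, Matrix.mulVec_smul, hT]
  module

/-- For an eigenvalue λ ∈ (0,1) of Ψl⁻¹ * Pl: 1 − λ is an eigenvalue of Φsym⁻¹ * S,
both 1 − (λ ± √λ)/2 are eigenvalues of Φadd⁻¹ * S, and
1 − (λ − √λ)/2 > 1 while 1 − (λ + √λ)/2 < 1 − λ. -/
theorem sym_spectrum_more_clustered {n m : ℕ} (hn : 0 < n) (hm : 0 < m)
    (S : Mat n m) (htri : IsBlockTridiag S) (hpd : S.PosDef)
    (lam : ℝ) (hlam0 : 0 < lam) (hlam1 : lam < 1)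
    (hev : ∃ v : Vec n m, v ≠ 0 ∧ ((stairL S)⁻¹ * Pl S) *ᵥ v = lam • v) :
    (∃ v : Vec n m, v ≠ 0 ∧ (Phisym S * S) *ᵥ v = (1 - lam) • v) ∧
      (∃ v : Vec n m, v ≠ 0 ∧
        (Phiadd S * S) *ᵥ v = (1 - (lam + Real.sqrt lam) / 2) • v) ∧
      (∃ v : Vec n m, v ≠ 0 ∧
        (Phiadd S * S) *ᵥ v = (1 - (lam - Real.sqrt lam) / 2) • v) ∧
      1 < 1 - (lam - Real.sqrt lam) / 2 ∧
      1 - (lam + Real.sqrt lam) / 2 < 1 - lam := by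
  obtain ⟨A, B, hA, hB, hl, hsym, hadd⟩ := exists_splitting htri hpd
  rw [hl] at hev
  obtain ⟨u, hu, hTu, hne⟩ := exists_sq_eigenvector hA hB hlam0.ne' hev
  have hs : √lam * √lam = lam := Real.mul_self_sqrt hlam0.le
  have hlt : lam < √lam := (Real.lt_sqrt hlam0.le).2 (by nlinarith)
  refine ⟨⟨u, hu, ?_⟩, ⟨_, hne (-√lam), ?_⟩, ⟨_, hne √lam, ?_⟩, by linarith, by linarith⟩
  · rw [hsym, Matrix.sub_mulVec, Matrix.one_mulVec, ← Matrix.mulVec_mulVec, hTu, sub_smul,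
      one_smul]
  · rw [hadd, eigenvector_of_sq_eigenvector (by rw [hTu, neg_mul_neg, hs]), neg_mul_neg, hs,
      sub_neg_eq_add]
  · rw [hadd, eigenvector_of_sq_eigenvector (by rw [hTu, hs]), hs]

end StairPrecond
end

section
/- Let Ψ be a stair matrix: a block tridiagonal matrix (n×n blocks of size m×m) whose off-diagonal blocks are nonzero only in block rows of a fixed parity (either only in odd-indexed block rows, or only in even-indexed block rows, 0-indexed). Then Ψ is invertible if and only if each of its n diagonal blocks is an invertible m×m matrix. -/
open Matrix

namespace StairPrecond

/-- If the blocks of `M` can be injectively labelled so that `M` is block triangular, then the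
determinant of `M` is the product of the determinants of its diagonal blocks. -/
theorem det_eq_prod_det_blockOf {n m : ℕ} (hm : 0 < m) (M : Mat n m) (key : Fin n → ℕ)
    (hkey : Function.Injective key)
    (hM : M.BlockTriangular (fun p => key p.1)) :
    M.det = ∏ i : Fin n, (blockOf M i i).det := by
  have himage : Finset.univ.image (fun p : Fin n × Fin m => key p.1) =
      Finset.univ.image key := by
    ext k
    simp only [Finset.mem_image, Finset.mem_univ, true_and]
    exact ⟨fun ⟨p, hp⟩ => ⟨p.1, hp⟩, fun ⟨i, hi⟩ => ⟨(i, ⟨0, hm⟩), hi⟩⟩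
  rw [hM.det, himage, Finset.prod_image hkey.injOn]
  refine Finset.prod_congr rfl fun i _ => ?_
  let e : Fin m ≃ {p : Fin n × Fin m // key p.1 = key i} :=
    { toFun := fun a => ⟨(i, a), rfl⟩
      invFun := fun p => p.1.2
      left_inv := fun _ => rfl
      right_inv := fun p => Subtype.ext (Prod.ext (hkey p.2).symm rfl) }
  exact (Matrix.det_submatrix_equiv_self e _).symm

/-- A block tridiagonal matrix whose off-diagonal blocks vanish outside a set of pairwise
non-adjacent block rows is invertible iff its diagonal blocks are. -/
theorem isUnit_iff_of_nonadjacent_rows {n m : ℕ} (hm : 0 < m) (M : Mat n m)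
    (htri : IsBlockTridiag M) (active : ℕ → Prop) [DecidablePred active]
    (hactive : ∀ k, active k → ¬ active (k + 1))
    (hzero : ∀ i j : Fin n, i ≠ j → ¬ active i.val → blockOf M i j = 0) :
    IsUnit M ↔ ∀ i : Fin n, IsUnit (blockOf M i i) := by
  let key : Fin n → ℕ := fun i => if active i.val then i.val else n + i.val
  have hkey : Function.Injective key := by
    intro i j hij
    have := i.isLt
    have := j.isLt
    apply Fin.ext
    simp only [key] at hij
    split_ifs at hij <;> omega
  have hM : M.BlockTriangular (fun p => key p.1) := by
    rintro ⟨i, a⟩ ⟨j, b⟩ hlt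
    have hne : i ≠ j := by
      rintro rfl
      exact lt_irrefl _ hlt
    suffices h : blockOf M i j = 0 from congrFun (congrFun h a) b
    by_cases hi : active i.val
    · have hj : active j.val := by
        by_contra hj
        have := i.isLt
        simp only [key, if_pos hi, if_neg hj] at hlt
        omega
      apply htri
      have hij : j.val ≠ i.val + 1 := fun h => hactive _ hi (h ▸ hj)
      have hji : i.val ≠ j.val + 1 := fun h => hactive _ hj (h ▸ hi)
      have := Fin.val_ne_of_ne hne
      omega
    · exact hzero i j hne hi
  simp only [Matrix.isUnit_iff_isUnit_det, det_eq_prod_det_blockOf hm M key hkey hM,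
    IsUnit.prod_univ_iff]

/-- A stair matrix is invertible if and only if all of its diagonal blocks are
invertible. -/
theorem stair_invertible_iff_diag_blocks_invertible {n m : ℕ} (hn : 0 < n) (hm : 0 < m)
    (Psi : Mat n m) (hstair : IsStairMatrix Psi) :
    IsUnit Psi ↔ ∀ i : Fin n, IsUnit (blockOf Psi i i) := by
  obtain ⟨htri, hzero | hzero⟩ := hstair
  · refine isUnit_iff_of_nonadjacent_rows hm Psi htri Odd (fun k hk => ?_) fun i j hij hi => ?_
    · exact Nat.not_odd_iff_even.mpr hk.add_one
    · exact hzero i j hij (Nat.not_odd_iff_even.mp hi)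
  · refine isUnit_iff_of_nonadjacent_rows hm Psi htri Even (fun k hk => ?_) fun i j hij hi => ?_
    · exact Nat.not_even_iff_odd.mpr hk.add_one
    · exact hzero i j hij (Nat.not_even_iff_odd.mp hi)

end StairPrecond
end
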